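/- Assume: (i) each P^(i) is row-stochastic and v^(i) ∈ ℝ^N satisfies (P^(i))ᵀ v^(i) = v^(i) with Σ_n v^(i)_n = 1; (ii) each P̃^(n) is row-stochastic. Define the effective interlayer transition matrix X̃ by X̃_{ij} = Σ_{n=1}^N v^(i)_n · P̃^(n)_{ij}, let α ∈ ℝ^I and set 𝕧₀ = Σ_{j=1}^I α_j · (e^(j) ⊗ v^(j)). Let 𝕂 be the interlayer coupling matrix with entries 𝕂_{(n,i),(m,j)} = δ_{nm}·P̃^(n)_{ij}. If there exists a vector 𝕧₁ ∈ ℝ^{N·I} satisfying the first-order consistency equation 𝕧₁ = ℙ(0)ᵀ 𝕧₁ − ℙ(0)ᵀ 𝕧₀ + 𝕂ᵀ 𝕧₀, then αᵀ X̃ = αᵀ, i.e. Σ_{j=1}^I α_j · X̃_{ji} = α_i for every i. -/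

import Mathlib

open Matrix BigOperators

/-- A square real matrix is row-stochastic if all entries are nonnegative
and every row sums to 1. -/
def IsRowStochastic {α : Type*} [Fintype α] (M : Matrix α α ℝ) : Prop :=
  (∀ p q, 0 ≤ M p q) ∧ ∀ p, ∑ q, M p q = 1

/-- The uncoupled supratransition matrix `ℙ(0)`: the block-diagonal matrix with
diagonal blocks `P^(1),…,P^(I)`. -/
def uncoupled (N I : ℕ) (P : Fin I → Matrix (Fin N) (Fin N) ℝ) :
    Matrix (Fin N × Fin I) (Fin N × Fin I) ℝ :=
  Matrix.of fun p q => if p.2 = q.2 then P q.2 p.1 q.1 else 0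

/-- The interlayer coupling matrix `𝕂`, with entries
`𝕂_{(n,i),(m,j)} = δ_{nm} · P̃^(n)_{ij}`. -/
def interK (N I : ℕ) (Pt : Fin N → Matrix (Fin I) (Fin I) ℝ) :
    Matrix (Fin N × Fin I) (Fin N × Fin I) ℝ :=
  Matrix.of fun p q => if p.1 = q.1 then Pt p.1 p.2 q.2 else 0

/-- The block vector `e^(i) ⊗ v ∈ ℝ^{N·I}`, with entries
`(e^(i) ⊗ v)_{(n,j)} = δ_{ij} · v_n`. -/
def blockVec (N I : ℕ) (i : Fin I) (v : Fin N → ℝ) : Fin N × Fin I → ℝ :=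
  fun p => if p.2 = i then v p.1 else 0

theorem unc_sum (N I : ℕ) (P : Fin I → Matrix (Fin N) (Fin N) ℝ)
    (hP : ∀ i, IsRowStochastic (P i)) (w : Fin N × Fin I → ℝ) (i : Fin I) :
    ∑ n, (uncoupled N I P)ᵀ.mulVec w (n, i) = ∑ n, w (n, i) := by
  have h : ∀ n, (uncoupled N I P)ᵀ.mulVec w (n, i) = ∑ m, P i m n * w (m, i) := by
    intro n
    simp [Matrix.mulVec, dotProduct, uncoupled, Fintype.sum_prod_type, ite_mul]
  simp_rw [h]
  rw [Finset.sum_comm]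
  simp_rw [← Finset.sum_mul, (hP i).2, one_mul]

theorem interK_apply (N I : ℕ) (Pt : Fin N → Matrix (Fin I) (Fin I) ℝ)
    (w : Fin N × Fin I → ℝ) (n : Fin N) (i : Fin I) :
    (interK N I Pt)ᵀ.mulVec w (n, i) = ∑ j, Pt n j i * w (n, j) := by
  simp [Matrix.mulVec, dotProduct, interK, Fintype.sum_prod_type_right, ite_mul]

/-- under the stated hypotheses, if some `𝕧₁` satisfies the
first-order consistency equation
`𝕧₁ = ℙ(0)ᵀ 𝕧₁ − ℙ(0)ᵀ 𝕧₀ + 𝕂ᵀ 𝕧₀`, then `αᵀ X̃ = αᵀ`,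
i.e. `Σ_j α_j X̃_{ji} = α_i` for every `i`. -/
theorem first_order_consistency (N I : ℕ) (hN : 0 < N) (hI : 0 < I)
    (P : Fin I → Matrix (Fin N) (Fin N) ℝ)
    (Pt : Fin N → Matrix (Fin I) (Fin I) ℝ)
    (hP : ∀ i, IsRowStochastic (P i))
    (hPt : ∀ n, IsRowStochastic (Pt n))
    (v : Fin I → Fin N → ℝ)
    (hv : ∀ i, (P i)ᵀ.mulVec (v i) = v i)
    (hvsum : ∀ i, ∑ n, v i n = 1)
    (Xt : Matrix (Fin I) (Fin I) ℝ)
    (hXt : ∀ i j, Xt i j = ∑ n, v i n * Pt n i j)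
    (α : Fin I → ℝ)
    (v0 : Fin N × Fin I → ℝ)
    (hv0 : v0 = ∑ j, α j • blockVec N I j (v j))
    (hex : ∃ v1 : Fin N × Fin I → ℝ,
      v1 = (uncoupled N I P)ᵀ.mulVec v1 - (uncoupled N I P)ᵀ.mulVec v0
        + (interK N I Pt)ᵀ.mulVec v0) :
    ∀ i, ∑ j, α j * Xt j i = α i := by
  intro i
  obtain ⟨v1, h1⟩ := hex
  have hv0' : ∀ n j, v0 (n, j) = α j * v j n := by
    intro n j
    simp [hv0, blockVec, Finset.sum_apply]
  have h2 : ∑ n, v1 (n, i) = ∑ n, ((uncoupled N I P)ᵀ.mulVec v1 (n, i)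
      - (uncoupled N I P)ᵀ.mulVec v0 (n, i) + (interK N I Pt)ᵀ.mulVec v0 (n, i)) :=
    Finset.sum_congr rfl fun n _ => congrFun h1 (n, i)
  rw [Finset.sum_add_distrib, Finset.sum_sub_distrib, unc_sum N I P hP, unc_sum N I P hP] at h2
  simp_rw [interK_apply, hv0'] at h2
  rw [← Finset.mul_sum, hvsum, Finset.sum_comm] at h2
  have h3 : ∑ j, α j * Xt j i = ∑ j, ∑ n, Pt n j i * (α j * v j n) := by
    refine Finset.sum_congr rfl fun j _ => ?_
    rw [hXt, Finset.mul_sum]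
    exact Finset.sum_congr rfl fun n _ => by ring
  rw [h3]
  linarith
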